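/- For every n ≥ 2, the Boolean lattice B_n is diametrally reversing: every linear extension of B_n that is contained in some diametral pair of linear extensions of B_n reverses a critical pair of B_n. -/

import Mathlib

open Finset
open scoped symmDiff

/-- `L` is a linear extension of the partial order on `α`. -/
def IsLinExt {α : Type*} [PartialOrder α] (L : α → α → Prop) : Prop :=
  IsLinearOrder α L ∧ ∀ x y : α, x ≤ y → L x y

/-- The number of unordered pairs of elements appearing in different orders in `L₁` and `L₂`,
counted via the ordered pairs that are strictly below in `L₁` and strictly above in `L₂`. -/
noncomputable def revCount {α : Type*} (L₁ L₂ : α → α → Prop) : ℕ :=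
  Set.ncard {p : α × α | p.1 ≠ p.2 ∧ L₁ p.1 p.2 ∧ L₂ p.2 p.1}

/-- The strict σ-revlex order on subsets of `[n]`: `S < T` iff the σ-largest element of the
symmetric difference `S ∆ T` belongs to `T`. -/
def SigmaRevLexLT {n : ℕ} (σ : Equiv.Perm (Fin n)) (S T : Finset (Fin n)) : Prop :=
  ∃ m ∈ T \ S, ∀ x ∈ S ∆ T, σ.symm x ≤ σ.symm m

/-- The σ-revlex linear extension `L_σ` of the Boolean lattice, as a reflexive relation. -/
def SigmaRevLex {n : ℕ} (σ : Equiv.Perm (Fin n)) (S T : Finset (Fin n)) : Prop :=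
  S = T ∨ SigmaRevLexLT σ S T

/-- The reverse `σ̄` of a permutation `σ` of `[n]`. -/
def revPermOf {n : ℕ} (σ : Equiv.Perm (Fin n)) : Equiv.Perm (Fin n) :=
  (Fin.revPerm : Equiv.Perm (Fin n)).trans σ

/-- An ordered pair `(x,y)` of a poset is a critical pair. -/
def IsCriticalPair {α : Type*} [PartialOrder α] (x y : α) : Prop :=
  ¬ x ≤ y ∧ ¬ y ≤ x ∧ (∀ z, z < x → z < y) ∧ (∀ z, y < z → x < z)

/-- The downsets of a finite poset, as a poset ordered by inclusion. -/
abbrev DownFinset (α : Type*) [PartialOrder α] : Type _ :=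
  {S : Finset α // IsLowerSet (↑S : Set α)}

/-- The strict σ-revlex order on downsets of a poset, for a linear extension `σ`. -/
def DRevLexLT {α : Type*} [PartialOrder α] [DecidableEq α] (σ : α → α → Prop)
    (S T : DownFinset α) : Prop :=
  ∃ m ∈ T.1 \ S.1, ∀ x ∈ S.1 ∆ T.1, σ x m

/-- The σ-revlex linear extension `L_σ` of the downset lattice, as a reflexive relation. -/
def DRevLex {α : Type*} [PartialOrder α] [DecidableEq α] (σ : α → α → Prop)
    (S T : DownFinset α) : Prop :=
  S = T ∨ DRevLexLT σ S T

/-- The comparability graph of the subposet induced on `D`. -/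
def compGraph {α : Type*} [PartialOrder α] (D : Set α) : SimpleGraph D :=
  SimpleGraph.fromRel fun x y => (x : α) ≤ (y : α)

/-- The number of connected components of the subposet induced on `D`. -/
noncomputable def numComponents {α : Type*} [PartialOrder α] (D : Set α) : ℕ :=
  Nat.card (compGraph D).ConnectedComponent

/-- `{σ, τ}` is a realizer of cardinality 2 of the partial order on `α`. -/
def IsRealizer2 {α : Type*} [PartialOrder α] (σ τ : α → α → Prop) : Prop :=
  IsLinExt σ ∧ IsLinExt τ ∧ ∀ x y : α, x ≤ y ↔ σ x y ∧ τ x y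

/-- A linear extension `π` is non-separating. -/
def NonSeparating {α : Type*} [PartialOrder α] (π : α → α → Prop) : Prop :=
  ¬ ∃ u v x : α, u < v ∧ ¬ x ≤ u ∧ ¬ u ≤ x ∧ ¬ x ≤ v ∧ ¬ v ≤ x ∧
      π u x ∧ u ≠ x ∧ π x v ∧ x ≠ v

/-- The principal downset of an element. -/
def pdown {α : Type*} [Fintype α] [PartialOrder α] [DecidableEq α]
    [DecidableRel ((· ≤ ·) : α → α → Prop)] (x : α) : DownFinset α :=
  ⟨Finset.univ.filter (· ≤ x), by
    intro a b hba ha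
    simp only [Finset.mem_coe, Finset.mem_filter] at ha ⊢
    exact ⟨Finset.mem_univ b, hba.trans ha.2⟩⟩

namespace IsLinExt

variable {α : Type*} [PartialOrder α] {L : α → α → Prop}

theorem of_le (h : IsLinExt L) {x y : α} (hxy : x ≤ y) : L x y := h.2 x y hxy

theorem trans (h : IsLinExt L) {x y z : α} (hxy : L x y) (hyz : L y z) : L x z :=
  h.1.trans x y z hxy hyz

theorem antisymm (h : IsLinExt L) {x y : α} (hxy : L x y) (hyx : L y x) : x = y :=
  h.1.antisymm x y hxy hyx

theorem total (h : IsLinExt L) (x y : α) : L x y ∨ L y x := h.1.total x y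

end IsLinExt

/-- Pulling back a linear order along a monotone injection gives a linear extension. -/
theorem isLinExt_of_monotone_of_injective {α β : Type*} [PartialOrder α] [LinearOrder β] {f : α → β}
    (hf : Monotone f) (hinj : Function.Injective f) : IsLinExt fun x y => f x ≤ f y :=
  ⟨{ refl := fun _ => le_rfl
     trans := fun _ _ _ => le_trans
     antisymm := fun _ _ h h' => hinj (le_antisymm h h')
     total := fun _ _ => le_total _ _ }, fun _ _ h => hf h⟩

theorem revCount_comm {α : Type*} (L₁ L₂ : α → α → Prop) : revCount L₁ L₂ = revCount L₂ L₁ := by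
  unfold revCount
  rw [← Set.ncard_image_of_injective _ Prod.swap_injective]
  congr 1
  ext ⟨x, y⟩
  simp only [Set.mem_image, Set.mem_ofPred_eq, Prod.exists, Prod.swap_prod_mk, Prod.mk.injEq]
  constructor
  · rintro ⟨a, b, ⟨h, h₁, h₂⟩, rfl, rfl⟩
    exact ⟨h.symm, h₂, h₁⟩
  · rintro ⟨h, h₁, h₂⟩
    exact ⟨y, x, ⟨h.symm, h₂, h₁⟩, rfl, rfl⟩

section ReversalClasses

variable {α : Type*} [DecidableEq α]

open Classical in
/-- The subsets `A ⊆ D` such that `U ∪ A` precedes `U ∪ (D \ A)` in `L`. -/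
noncomputable def lowerHalf (L : Finset α → Finset α → Prop) (U D : Finset α) :
    Finset (Finset α) :=
  {A ∈ D.powerset | L (U ∪ A) (U ∪ (D \ A))}

open Classical in
/-- The subsets `A ⊆ D` such that `U ∪ A` and `U ∪ (D \ A)` form a reversal of `L₁` and `L₂`,
with `U ∪ A` coming first in `L₁`. -/
noncomputable def revClass (L₁ L₂ : Finset α → Finset α → Prop) (U D : Finset α) :
    Finset (Finset α) :=
  {A ∈ D.powerset | L₁ (U ∪ A) (U ∪ (D \ A)) ∧ L₂ (U ∪ (D \ A)) (U ∪ A)}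

open Classical in
/-- The reversals `(S, T)` of `L₁` and `L₂` with `S ∩ T = U` and `S ∆ T = D`. -/
noncomputable def revFiber [Fintype α] (L₁ L₂ : Finset α → Finset α → Prop) (U D : Finset α) :
    Finset (Finset α × Finset α) :=
  {p | (p.1 ≠ p.2 ∧ L₁ p.1 p.2 ∧ L₂ p.2 p.1) ∧ (p.1 ∩ p.2, p.1 ∆ p.2) = (U, D)}

theorem mem_lowerHalf {L : Finset α → Finset α → Prop} {U D A : Finset α} :
    A ∈ lowerHalf L U D ↔ A ⊆ D ∧ L (U ∪ A) (U ∪ (D \ A)) := by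
  simp [lowerHalf]

theorem mem_revClass {L₁ L₂ : Finset α → Finset α → Prop} {U D A : Finset α} :
    A ∈ revClass L₁ L₂ U D ↔
      A ⊆ D ∧ L₁ (U ∪ A) (U ∪ (D \ A)) ∧ L₂ (U ∪ (D \ A)) (U ∪ A) := by
  simp [revClass]

theorem mem_revFiber [Fintype α] {L₁ L₂ : Finset α → Finset α → Prop} {U D : Finset α}
    {p : Finset α × Finset α} :
    p ∈ revFiber L₁ L₂ U D ↔
      (p.1 ≠ p.2 ∧ L₁ p.1 p.2 ∧ L₂ p.2 p.1) ∧ p.1 ∩ p.2 = U ∧ p.1 ∆ p.2 = D := by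
  simp [revFiber]

theorem revCount_eq_sum_card_revFiber [Fintype α] (L₁ L₂ : Finset α → Finset α → Prop) :
    revCount L₁ L₂ = ∑ q : Finset α × Finset α, #(revFiber L₁ L₂ q.1 q.2) := by
  classical
  rw [revCount, Set.ncard_eq_toFinset_card',
    card_eq_sum_card_fiberwise (f := fun p => (p.1 ∩ p.2, p.1 ∆ p.2)) (t := univ) (by simp)]
  refine sum_congr rfl fun q _ => congrArg card ?_
  ext p
  simp [revFiber]

theorem union_ne_union_sdiff {U D A : Finset α} (hUD : Disjoint U D) (hD : D.Nonempty) :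
    U ∪ A ≠ U ∪ (D \ A) := by
  obtain ⟨x, hx⟩ := hD
  intro h
  have hxU : x ∉ U := fun h => disjoint_left.1 hUD h hx
  have := congrArg (x ∈ ·) h
  simp [hxU, hx] at this

theorem card_revFiber [Fintype α] (L₁ L₂ : Finset α → Finset α → Prop) {U D : Finset α}
    (hUD : Disjoint U D) (hD : D.Nonempty) :
    #(revFiber L₁ L₂ U D) = #(revClass L₁ L₂ U D) := by
  have key : ∀ p : Finset α × Finset α,
      (p.1 ∩ p.2) ∪ (p.1 \ p.2) = p.1 ∧ (p.1 ∩ p.2) ∪ ((p.1 ∆ p.2) \ (p.1 \ p.2)) = p.2 := by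
    intro p
    constructor <;> ext x <;> simp [mem_symmDiff] <;> tauto
  refine card_bij' (fun p _ => p.1 \ p.2) (fun A _ => (U ∪ A, U ∪ (D \ A))) ?_ ?_ ?_ ?_
  · intro p hp
    obtain ⟨⟨-, h₁, h₂⟩, rfl, rfl⟩ := mem_revFiber.1 hp
    rw [mem_revClass, (key p).1, (key p).2]
    exact ⟨fun x hx => mem_symmDiff.2 (Or.inl (mem_sdiff.1 hx)), h₁, h₂⟩
  · intro A hA
    obtain ⟨hAD, h₁, h₂⟩ := mem_revClass.1 hA
    refine mem_revFiber.2 ⟨⟨union_ne_union_sdiff hUD hD, h₁, h₂⟩, ?_, ?_⟩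
    · ext x
      simp
      tauto
    · ext x
      have h₁ := @hAD x
      have h₂ := fun hxU : x ∈ U => disjoint_left.1 hUD hxU
      simp [mem_symmDiff]
      tauto
  · intro p hp
    obtain ⟨-, rfl, rfl⟩ := mem_revFiber.1 hp
    exact Prod.ext (key p).1 (key p).2
  · intro A hA
    obtain ⟨hAD, -⟩ := mem_revClass.1 hA
    ext x
    have h₁ := @hAD x
    have h₂ := fun hxU : x ∈ U => disjoint_left.1 hUD hxU
    simp
    tauto

theorem isLowerSet_lowerHalf {L : Finset α → Finset α → Prop} (hL : IsLinExt L)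
    (U D : Finset α) : IsLowerSet (lowerHalf L U D : Set (Finset α)) := by
  intro A B hBA hA
  obtain ⟨hAD, h⟩ := mem_lowerHalf.1 (mem_coe.1 hA)
  refine mem_coe.2 (mem_lowerHalf.2 ⟨hBA.trans hAD, ?_⟩)
  exact hL.trans (hL.of_le (union_subset_union_right hBA))
    (hL.trans h (hL.of_le (union_subset_union_right (sdiff_subset_sdiff le_rfl hBA))))

theorem not_mem_lowerHalf {L : Finset α → Finset α → Prop} (hL : IsLinExt L)
    {U D A : Finset α} (hUD : Disjoint U D) (hD : D.Nonempty) (hAD : A ⊆ D) :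
    A ∉ lowerHalf L U D ↔ L (U ∪ (D \ A)) (U ∪ A) := by
  rw [mem_lowerHalf, not_and]
  exact ⟨fun h => (hL.total _ _).resolve_left (h hAD), fun h _ h' =>
    union_ne_union_sdiff hUD hD (hL.antisymm h' h)⟩

theorem two_mul_card_lowerHalf {L : Finset α → Finset α → Prop} (hL : IsLinExt L)
    {U D : Finset α} (hUD : Disjoint U D) (hD : D.Nonempty) :
    2 * #(lowerHalf L U D) = 2 ^ #D := by
  have hsub : lowerHalf L U D ⊆ D.powerset := fun A hA => mem_powerset.2 (mem_lowerHalf.1 hA).1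
  have hcard : #(lowerHalf L U D) = #(D.powerset \ lowerHalf L U D) := by
    refine card_bij' (fun A _ => D \ A) (fun A _ => D \ A) ?_ ?_ ?_ ?_
    · intro A hA
      obtain ⟨hAD, h⟩ := mem_lowerHalf.1 hA
      rw [mem_sdiff, mem_powerset, not_mem_lowerHalf hL hUD hD sdiff_subset,
        Finset.sdiff_sdiff_eq_self hAD]
      exact ⟨sdiff_subset, h⟩
    · intro A hA
      rw [mem_sdiff, mem_powerset] at hA
      rw [mem_lowerHalf, Finset.sdiff_sdiff_eq_self hA.1]
      exact ⟨sdiff_subset, (not_mem_lowerHalf hL hUD hD hA.1).1 hA.2⟩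
    · exact fun A hA => Finset.sdiff_sdiff_eq_self (mem_lowerHalf.1 hA).1
    · exact fun A hA => Finset.sdiff_sdiff_eq_self (mem_powerset.1 (mem_sdiff.1 hA).1)
  have := card_sdiff_add_card_eq_card hsub
  rw [card_powerset] at this
  omega

theorem revClass_eq_sdiff {L₁ L₂ : Finset α → Finset α → Prop} (hL₂ : IsLinExt L₂)
    {U D : Finset α} (hUD : Disjoint U D) (hD : D.Nonempty) :
    revClass L₁ L₂ U D = lowerHalf L₁ U D \ lowerHalf L₂ U D := by
  ext A
  rw [mem_sdiff, mem_revClass, mem_lowerHalf, and_assoc]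
  refine and_congr_right fun hAD => and_congr_right fun _ => ?_
  rw [not_mem_lowerHalf hL₂ hUD hD hAD]

/-- By the Harris–Kleitman inequality, at most half of the complementary pairs of an interval of
the Boolean lattice are reversed. -/
theorem four_mul_card_revClass_le {L₁ L₂ : Finset α → Finset α → Prop} (hL₁ : IsLinExt L₁)
    (hL₂ : IsLinExt L₂) {U D : Finset α} (hUD : Disjoint U D) (hD : D.Nonempty) :
    4 * #(revClass L₁ L₂ U D) ≤ 2 ^ #D := by
  have h := (isLowerSet_lowerHalf hL₁ U D).le_card_inter_finset' (isLowerSet_lowerHalf hL₂ U D)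
    (fun A hA => (mem_lowerHalf.1 hA).1) (fun A hA => (mem_lowerHalf.1 hA).1)
  have h₁ := two_mul_card_lowerHalf hL₁ hUD hD
  have h₂ := two_mul_card_lowerHalf hL₂ hUD hD
  have h₃ := card_sdiff_add_card_inter (lowerHalf L₁ U D) (lowerHalf L₂ U D)
  rw [revClass_eq_sdiff hL₂ hUD hD]
  have hpos : 0 < 2 ^ #D := by positivity
  have h₄ : 2 ^ #D ≤ 4 * #(lowerHalf L₁ U D ∩ lowerHalf L₂ U D) := by
    refine Nat.le_of_mul_le_mul_left ?_ hpos
    calc 2 ^ #D * 2 ^ #D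
        = 4 * (#(lowerHalf L₁ U D) * #(lowerHalf L₂ U D)) := by
          nth_rewrite 1 [← h₁]
          rw [← h₂]
          ring
      _ ≤ 4 * (2 ^ #D * #(lowerHalf L₁ U D ∩ lowerHalf L₂ U D)) := by gcongr
      _ = _ := by ring
  omega

theorem revFiber_eq_empty [Fintype α] (L₁ L₂ : Finset α → Finset α → Prop) {U D : Finset α}
    (h : ¬ (Disjoint U D ∧ D.Nonempty)) : revFiber L₁ L₂ U D = ∅ := by
  refine eq_empty_of_forall_notMem fun p hp => h ?_
  obtain ⟨⟨hne, -⟩, rfl, rfl⟩ := mem_revFiber.1 hp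
  refine ⟨disjoint_left.2 fun x hx hx' => ?_, symmDiff_nonempty.2 hne⟩
  simp only [mem_inter, mem_symmDiff] at hx hx'
  tauto

end ReversalClasses

section Extremal

/-- The colexicographic linear extension of a Boolean lattice. -/
def ColexLE {α : Type*} [LinearOrder α] (S T : Finset α) : Prop :=
  toColex S ≤ toColex T

/-- The colexicographic linear extension with respect to the dual order of the ground set. -/
def DualColexLE {α : Type*} [LinearOrder α] (S T : Finset α) : Prop :=
  toColex (S.map OrderDual.toDual.toEmbedding) ≤ toColex (T.map OrderDual.toDual.toEmbedding)

variable {α : Type*} [LinearOrder α]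

theorem isLinExt_colexLE : IsLinExt (ColexLE (α := α)) :=
  isLinExt_of_monotone_of_injective Finset.Colex.toColex_mono toColex.injective

theorem isLinExt_dualColexLE : IsLinExt (DualColexLE (α := α)) :=
  isLinExt_of_monotone_of_injective (f := fun S : Finset α => toColex (S.map OrderDual.toDual.toEmbedding))
    (fun _ _ h => Finset.Colex.toColex_mono (map_subset_map.2 h))
    (toColex.injective.comp (map_injective _))

theorem le_four_mul_card_revClass_colex {U D : Finset α} (hUD : Disjoint U D) (hD : 2 ≤ #D) :
    2 ^ #D ≤ 4 * #(revClass ColexLE DualColexLE U D) := by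
  have hne : D.Nonempty := card_pos.1 (by omega)
  have hab : D.min' hne < D.max' hne := min'_lt_max'_of_card D (by omega)
  have haD := D.min'_mem hne
  have hbD := D.max'_mem hne
  have hmin : ∀ x ∈ D, D.min' hne ≤ x := fun x hx => D.min'_le x hx
  have hmax : ∀ x ∈ D, x ≤ D.max' hne := fun x hx => D.le_max' x hx
  generalize D.min' hne = a at *
  generalize D.max' hne = b at *
  have hle : #((D.erase b).erase a).powerset ≤ #(revClass ColexLE DualColexLE U D) := by
    refine card_le_card_of_injOn (insert a) ?_ ?_
    · intro A hA
      rw [mem_coe, mem_powerset] at hA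
      have hAD : insert a A ⊆ D :=
        insert_subset haD (hA.trans ((erase_subset _ _).trans (erase_subset _ _)))
      have hbA : b ∉ insert a A := by
        rw [mem_insert, not_or]
        exact ⟨hab.ne', fun h => by simpa using hA h⟩
      have haU : a ∉ U := fun h => disjoint_left.1 hUD h haD
      have hbU : b ∉ U := fun h => disjoint_left.1 hUD h hbD
      refine mem_coe.2 (mem_revClass.2 ⟨hAD, ?_, ?_⟩)
      · refine Finset.Colex.toColex_le_toColex.2 fun x hx hx' => ⟨b, ?_, ?_, ?_⟩
        · simp only [mem_union, mem_sdiff]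
          exact Or.inr ⟨hbD, hbA⟩
        · rw [mem_union, not_or]
          exact ⟨hbU, hbA⟩
        · rw [mem_union, not_or] at hx'
          exact hmax x (hAD ((mem_union.1 hx).resolve_left hx'.1))
      · refine Finset.Colex.toColex_le_toColex.2 fun x hx hx' =>
          ⟨OrderDual.toDual a, ?_, ?_, ?_⟩
        · simp
        · simp [haU]
        · induction x using OrderDual.rec with | _ x =>
          simp only [mem_map_equiv, OrderDual.toDual_symm_eq, OrderDual.ofDual_toDual, mem_union,
            not_or] at hx hx'
          rw [OrderDual.toDual_le_toDual]
          exact hmin x (mem_sdiff.1 (hx.resolve_left hx'.1)).1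
    · intro A hA B hB h
      have hA' : a ∉ A := fun h => by simpa using (mem_powerset.1 (mem_coe.1 hA)) h
      have hB' : a ∉ B := fun h => by simpa using (mem_powerset.1 (mem_coe.1 hB)) h
      rw [← erase_insert hA', ← erase_insert hB', h]
  rw [card_powerset, card_erase_of_mem (mem_erase.2 ⟨hab.ne, haD⟩), card_erase_of_mem hbD] at hle
  calc 2 ^ #D = 4 * 2 ^ (#D - 1 - 1) := by
        obtain ⟨k, hk⟩ := Nat.exists_eq_add_of_le hD
        rw [hk, show 2 + k - 1 - 1 = k by omega]
        ring
    _ ≤ _ := by gcongr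

theorem card_revFiber_le_card_revFiber_colex [Fintype α] {L₁ L₂ : Finset α → Finset α → Prop}
    (hL₁ : IsLinExt L₁) (hL₂ : IsLinExt L₂) (U D : Finset α) :
    #(revFiber L₁ L₂ U D) ≤ #(revFiber ColexLE DualColexLE U D) := by
  by_cases h : Disjoint U D ∧ D.Nonempty
  · obtain ⟨hUD, hD⟩ := h
    rw [card_revFiber _ _ hUD hD, card_revFiber _ _ hUD hD]
    have h₁ := four_mul_card_revClass_le hL₁ hL₂ hUD hD
    rcases Nat.lt_or_ge #D 2 with h₂ | h₂
    · have : #D = 1 := by have := hD.card_pos; omega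
      rw [this] at h₁
      omega
    · have := le_four_mul_card_revClass_colex hUD h₂
      omega
  · rw [revFiber_eq_empty _ _ h]
    simp

/-- In a diametral pair, every class of complementary pairs attains the Harris–Kleitman bound. -/
theorem le_four_mul_card_revClass_of_diametral [Fintype α] {L₁ L₂ : Finset α → Finset α → Prop}
    (hL₁ : IsLinExt L₁) (hL₂ : IsLinExt L₂)
    (h : revCount (ColexLE (α := α)) DualColexLE ≤ revCount L₁ L₂) {U D : Finset α}
    (hUD : Disjoint U D) (hD : 2 ≤ #D) : 2 ^ #D ≤ 4 * #(revClass L₁ L₂ U D) := by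
  have hle : ∀ q ∈ (univ : Finset (Finset α × Finset α)),
      #(revFiber L₁ L₂ q.1 q.2) ≤ #(revFiber ColexLE DualColexLE q.1 q.2) :=
    fun q _ => card_revFiber_le_card_revFiber_colex hL₁ hL₂ q.1 q.2
  rw [revCount_eq_sum_card_revFiber, revCount_eq_sum_card_revFiber] at h
  have heq := (sum_eq_sum_iff_of_le hle).1 (le_antisymm (sum_le_sum hle) h) (U, D) (mem_univ _)
  have hne : D.Nonempty := card_pos.1 (by omega)
  rw [card_revFiber _ _ hUD hne, card_revFiber _ _ hUD hne] at heq
  rw [heq]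
  exact le_four_mul_card_revClass_colex hUD hD

end Extremal

section Top

variable {α : Type*} [DecidableEq α]

/-- Every singleton of a subset of `D` that comes last in `L` among the singletons of `D` comes
after its complement in `D`. -/
def TopDominates (L : Finset α → Finset α → Prop) (D : Finset α) : Prop :=
  ∀ m ∈ D, (∀ x ∈ D, L {x} {m}) → L (D.erase m) {m}

theorem exists_last_singleton {L : Finset α → Finset α → Prop} (hL : IsLinExt L)
    {D : Finset α} (hD : D.Nonempty) : ∃ m ∈ D, ∀ x ∈ D, L {x} {m} := by
  induction hD using Finset.Nonempty.cons_induction with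
  | singleton a => exact ⟨a, by simp, by simpa using hL.of_le le_rfl⟩
  | cons a s ha hs ih =>
    obtain ⟨m, hm, h⟩ := ih
    rcases hL.total {a} {m} with h' | h'
    · exact ⟨m, by simp [hm], by simpa using ⟨h', h⟩⟩
    · exact ⟨a, by simp, by simpa using ⟨hL.of_le le_rfl, fun x hx => hL.trans (h x hx) h'⟩⟩

theorem lt_sdiff_of_topDominates {L : Finset α → Finset α → Prop} (hL : IsLinExt L)
    {D A : Finset α} {m : α} (hm : m ∈ D) (hmax : ∀ x ∈ D, L {x} {m})
    (ih : ∀ E ⊂ D, 2 ≤ #E → TopDominates L E) (hAD : A ⊆ D) (hmA : m ∉ A)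
    (hA : A ≠ D.erase m) : L A (D \ A) := by
  have hle : L {m} (D \ A) := hL.of_le (singleton_subset_iff.2 (mem_sdiff.2 ⟨hm, hmA⟩))
  rcases A.eq_empty_or_nonempty with rfl | hne
  · exact hL.of_le (empty_subset _)
  · have hsub : insert m A ⊆ D := insert_subset hm hAD
    have hss : insert m A ⊂ D := by
      refine hsub.ssubset_of_ne fun h => hA ?_
      rw [← h, erase_insert hmA]
    have := ih _ hss (by rw [card_insert_of_notMem hmA]; have := hne.card_pos; omega) m
      (mem_insert_self _ _) (fun x hx => hmax x (hsub hx))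
    rw [erase_insert hmA] at this
    exact hL.trans this hle

theorem topDominates_of_ssubset {L₁ L₂ : Finset α → Finset α → Prop} (hL₁ : IsLinExt L₁)
    (hL₂ : IsLinExt L₂) {D : Finset α} (hD : 3 ≤ #D)
    (hrev : ∀ x ∈ D, ∀ y ∈ D, x ≠ y → L₁ {x} {y} → L₂ {y} {x})
    (hcard : 2 ^ #D ≤ 4 * #(revClass L₁ L₂ ∅ D))
    (ih₁ : ∀ E ⊂ D, 2 ≤ #E → TopDominates L₁ E) (ih₂ : ∀ E ⊂ D, 2 ≤ #E → TopDominates L₂ E) :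
    TopDominates L₁ D := by
  intro m hm hmax
  by_contra hcon
  have hne : D.Nonempty := ⟨m, hm⟩
  obtain ⟨a, ha, hamax⟩ := exists_last_singleton hL₂ hne
  have ham : a ≠ m := by
    rintro rfl
    obtain ⟨x, hx, hxa⟩ := exists_mem_ne (show 1 < #D by omega) a
    exact hxa (singleton_injective
      (hL₂.antisymm (hamax x hx) (hrev x hx a ha hxa (hmax x hx))))
  have hself : ∀ A, A ≠ D \ A := fun A h => by
    simpa using union_ne_union_sdiff (disjoint_empty_left D) hne (by simpa using h)
  have hmem : ∀ A ∈ revClass L₁ L₂ ∅ D, m ∉ A ∧ a ∈ A ∧ A ≠ D.erase m := by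
    intro A hA
    simp only [mem_revClass, empty_union] at hA
    obtain ⟨hAD, h₁, h₂⟩ := hA
    have hcompl : D \ (D \ A) = A := Finset.sdiff_sdiff_eq_self hAD
    have ha' : a ∉ A → A = D.erase a := fun haA => by
      by_contra hA
      exact hself A
        (hL₂.antisymm (lt_sdiff_of_topDominates hL₂ ha hamax ih₂ hAD haA hA) h₂)
    have hm' : m ∈ A → D \ A = D.erase m := fun hmA => by
      by_contra hA
      have := lt_sdiff_of_topDominates hL₁ hm hmax ih₁ (sdiff_subset (s := D) (t := A))
        (by simp [hmA]) hA
      rw [hcompl] at this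
      exact hself A (hL₁.antisymm h₁ this)
    have hmA : m ∉ A := fun hmA => by
      have hA : A = {m} := by
        rw [← hcompl, hm' hmA, ← sdiff_singleton_eq_erase,
          Finset.sdiff_sdiff_eq_self (singleton_subset_iff.2 hm)]
      have h := ha' (by simpa [hA] using ham)
      have := congrArg card h
      rw [hA, card_singleton, card_erase_of_mem ha] at this
      omega
    refine ⟨hmA, ?_, ?_⟩
    · by_contra haA
      rw [ha' haA] at hmA
      exact hmA (mem_erase.2 ⟨ham.symm, hm⟩)
    · rintro rfl
      apply hcon
      rwa [← sdiff_singleton_eq_erase, Finset.sdiff_sdiff_eq_self (singleton_subset_iff.2 hm),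
        sdiff_singleton_eq_erase] at h₁
  have hcard_lt : #(revClass L₁ L₂ ∅ D) < #((D.erase m).erase a).powerset := by
    rw [← card_image_of_injOn (f := fun A => A.erase a) (s := revClass L₁ L₂ ∅ D)]
    · refine card_lt_card ((ssubset_iff_of_subset ?_).2 ⟨(D.erase m).erase a, by simp, ?_⟩)
      · refine image_subset_iff.2 fun A hA => mem_powerset.2 (erase_subset_erase _ ?_)
        exact subset_erase.2 ⟨(mem_revClass.1 hA).1, (hmem A hA).1⟩
      · rintro h
        obtain ⟨A, hA, h⟩ := mem_image.1 h
        refine (hmem A hA).2.2 ?_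
        rw [← insert_erase (hmem A hA).2.1, h, insert_erase (mem_erase.2 ⟨ham, ha⟩)]
    · intro A hA B hB h
      rw [← insert_erase (hmem A hA).2.1, ← insert_erase (hmem B hB).2.1]
      exact congrArg (insert a) h
  rw [card_powerset, card_erase_of_mem (mem_erase.2 ⟨ham, ha⟩), card_erase_of_mem hm] at hcard_lt
  obtain ⟨k, hk⟩ := Nat.exists_eq_add_of_le hD
  rw [hk, show 3 + k - 1 - 1 = k + 1 by omega] at hcard_lt
  rw [hk] at hcard
  ring_nf at hcard hcard_lt
  omega

theorem reverses_singletons {L₁ L₂ : Finset α → Finset α → Prop} (hL₁ : IsLinExt L₁)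
    (hL₂ : IsLinExt L₂) {x y : α} (hxy : x ≠ y) (hcard : 0 < #(revClass L₁ L₂ ∅ {x, y}))
    (h : L₁ {x} {y}) : L₂ {y} {x} := by
  obtain ⟨A, hA⟩ := card_pos.1 hcard
  simp only [mem_revClass, empty_union] at hA
  obtain ⟨hAD, h₁, h₂⟩ := hA
  by_cases hx : x ∈ A <;> by_cases hy : y ∈ A
  · have hA : {x, y} \ A = ∅ := by grind
    rw [hA] at h₁
    have := hL₁.antisymm h₁ (hL₁.of_le (empty_subset _))
    simp [this] at hx
  · rwa [show A = {x} by grind, show ({x, y} : Finset α) \ {x} = {y} by grind] at h₂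
  · rw [show A = {y} by grind, show ({x, y} : Finset α) \ {y} = {x} by grind] at h₁
    exact absurd (hL₁.antisymm h h₁) (by simpa using hxy)
  · have hA : A = ∅ := by grind
    rw [hA] at h₂
    have := hL₂.antisymm h₂ (hL₂.of_le (empty_subset _))
    simp at this

theorem topDominates_of_card_revClass {L₁ L₂ : Finset α → Finset α → Prop} (hL₁ : IsLinExt L₁)
    (hL₂ : IsLinExt L₂)
    (hcard : ∀ D : Finset α, 2 ≤ #D → 2 ^ #D ≤ 4 * #(revClass L₁ L₂ ∅ D))
    (hcard' : ∀ D : Finset α, 2 ≤ #D → 2 ^ #D ≤ 4 * #(revClass L₂ L₁ ∅ D))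
    (D : Finset α) (hD : 2 ≤ #D) : TopDominates L₁ D ∧ TopDominates L₂ D := by
  have pos : ∀ {M₁ M₂ : Finset α → Finset α → Prop},
      (∀ D : Finset α, 2 ≤ #D → 2 ^ #D ≤ 4 * #(revClass M₁ M₂ ∅ D)) →
      ∀ {x y : α}, x ≠ y → 0 < #(revClass M₁ M₂ ∅ {x, y}) := fun h x y hxy => by
    have := h {x, y} (card_pair hxy).ge
    rw [card_pair hxy] at this
    omega
  induction D using Finset.strongInduction with
  | H D ih =>
    rcases hD.eq_or_lt with h | h
    · have base : ∀ L : Finset α → Finset α → Prop, TopDominates L D := by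
        intro L m hm hmax
        obtain ⟨y, hy⟩ := card_eq_one.1 (show #(D.erase m) = 1 by
          rw [card_erase_of_mem hm]; omega)
        rw [hy]
        exact hmax y (mem_of_mem_erase (a := m) (by simp [hy]))
      exact ⟨base L₁, base L₂⟩
    · exact ⟨topDominates_of_ssubset hL₁ hL₂ h
          (fun x _ y _ hxy => reverses_singletons hL₁ hL₂ hxy (pos hcard hxy)) (hcard D hD)
          (fun E hE hE' => (ih E hE hE').1) (fun E hE hE' => (ih E hE hE').2),
        topDominates_of_ssubset hL₂ hL₁ h
          (fun x _ y _ hxy => reverses_singletons hL₂ hL₁ hxy (pos hcard' hxy)) (hcard' D hD)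
          (fun E hE hE' => (ih E hE hE').2) (fun E hE hE' => (ih E hE hE').1)⟩

theorem isCriticalPair_singleton_erase [Fintype α] (h : 2 ≤ Fintype.card α) (m : α) :
    IsCriticalPair {m} (univ.erase m) := by
  obtain ⟨x, -, hx⟩ := exists_mem_ne (s := (univ : Finset α)) (by rwa [card_univ]) m
  have hxm : x ∈ (univ : Finset α).erase m := by simp [hx]
  refine ⟨by simp, fun h => hx (by simpa using h hxm), fun z hz => ?_, fun z hz => ?_⟩
  · rw [ssubset_singleton_iff.1 hz]
    exact empty_ssubset.2 ⟨x, hxm⟩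
  · obtain ⟨y, hy, hym⟩ := exists_of_ssubset hz
    obtain rfl : y = m := by simpa using hym
    refine (ssubset_iff_of_subset (singleton_subset_iff.2 hy)).2 ⟨x, hz.1 hxm, by simpa using hx⟩

end Top

/-- For every `n ≥ 2`, the Boolean lattice is diametrally reversing: every linear
extension contained in some diametral pair reverses a critical pair. -/
theorem boolean_diametrally_reversing (n : ℕ) (hn : 2 ≤ n)
    (L L' : Finset (Fin n) → Finset (Fin n) → Prop)
    (hL : IsLinExt L) (hL' : IsLinExt L')
    (hdiam : (∀ M₁ M₂ : Finset (Fin n) → Finset (Fin n) → Prop,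
        IsLinExt M₁ → IsLinExt M₂ → revCount M₁ M₂ ≤ revCount L L') ∨
      (∀ M₁ M₂ : Finset (Fin n) → Finset (Fin n) → Prop,
        IsLinExt M₁ → IsLinExt M₂ → revCount M₁ M₂ ≤ revCount L' L)) :
    ∃ x y : Finset (Fin n), IsCriticalPair x y ∧ L y x := by
  have key : ∀ M M' : Finset (Fin n) → Finset (Fin n) → Prop, IsLinExt M → IsLinExt M' →
      revCount (ColexLE (α := Fin n)) DualColexLE ≤ revCount M M' → ∀ D : Finset (Fin n),
      2 ≤ #D → 2 ^ #D ≤ 4 * #(revClass M M' ∅ D) := fun M M' hM hM' h D hD =>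
    le_four_mul_card_revClass_of_diametral hM hM' h (disjoint_empty_left D) hD
  have hmax : revCount (ColexLE (α := Fin n)) DualColexLE ≤ revCount L L' := by
    rcases hdiam with h | h
    · exact h _ _ isLinExt_colexLE isLinExt_dualColexLE
    · rw [revCount_comm L L']
      exact h _ _ isLinExt_colexLE isLinExt_dualColexLE
  have hcard : 2 ≤ #(univ : Finset (Fin n)) := by simpa using hn
  obtain ⟨m, hm, hlast⟩ :=
    exists_last_singleton hL (card_pos.1 (show 0 < #(univ : Finset (Fin n)) by omega))
  have htop := (topDominates_of_card_revClass hL hL' (key L L' hL hL' hmax)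
    (key L' L hL' hL (revCount_comm L L' ▸ hmax)) univ hcard).1
  exact ⟨{m}, univ.erase m, isCriticalPair_singleton_erase (by simpa using hn) m,
    htop m hm hlast⟩
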